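/- Let (α_n) be a sequence with α_n > −1 such that α_n/n → a for some a ≥ 0 as n → ∞. Set r_1 = 2 + a − 2√(1+a) and r_2 = 2 + a + 2√(1+a). Then for every ξ with r_1 ≤ ξ ≤ r_2, lim_{n→∞} (1/n)·N^{(α_n)}(n·ξ) = (1/(2π)) · ∫_{r_1}^{ξ} √((r_2−x)(x−r_1))/x dx. -/

import Mathlib

open Filter Topology

/-- Generalized binomial coefficient C(t, m) = t(t-1)⋯(t-m+1)/m! for real t. -/
noncomputable def genBinom (t : ℝ) (m : ℕ) : ℝ :=
  (∏ i ∈ Finset.range m, (t - (i : ℝ))) / (Nat.factorial m)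

/-- Laguerre polynomial L_n^{(α)}. -/
noncomputable def laguerreL (n : ℕ) (α : ℝ) (x : ℝ) : ℝ :=
  ∑ k ∈ Finset.range (n + 1),
    (-1) ^ k * genBinom ((n : ℝ) + α) (n - k) * x ^ k / (Nat.factorial k)

/-- Number of zeros of L_n^{(α)} that are ≤ ξ. -/
noncomputable def laguerreN (n : ℕ) (α ξ : ℝ) : ℕ :=
  {x : ℝ | laguerreL n α x = 0 ∧ x ≤ ξ}.ncard

/-- The coefficient of `x ^ k` in the Laguerre polynomial. -/
noncomputable def laguerreCoeff (n : ℕ) (α : ℝ) (k : ℕ) : ℝ :=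
  if k ≤ n then (-1) ^ k * genBinom ((n : ℝ) + α) (n - k) / (Nat.factorial k) else 0

/-- The Laguerre polynomial as an element of `ℝ[X]`. -/
noncomputable def laguerrePoly (n : ℕ) (α : ℝ) : Polynomial ℝ :=
  ∑ k ∈ Finset.range (n + 1), Polynomial.monomial k (laguerreCoeff n α k)

lemma genBinom_succ (t : ℝ) (m : ℕ) :
    (m + 1 : ℝ) * genBinom t (m + 1) = (t - m) * genBinom t m := by
  have h : (Nat.factorial m : ℝ) ≠ 0 := by positivity
  simp only [genBinom, Finset.prod_range_succ, Nat.factorial_succ]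
  push_cast
  field_simp

lemma coeff_laguerrePoly (n : ℕ) (α : ℝ) (k : ℕ) :
    (laguerrePoly n α).coeff k = laguerreCoeff n α k := by
  simp only [laguerrePoly, Polynomial.finsetSum_coeff, Polynomial.coeff_monomial,
    Finset.sum_ite_eq', Finset.mem_range]
  split_ifs with h
  · rfl
  · rw [laguerreCoeff, if_neg (by omega)]

lemma eval_laguerrePoly (n : ℕ) (α x : ℝ) :
    (laguerrePoly n α).eval x = laguerreL n α x := by
  simp only [laguerrePoly, laguerreL, Polynomial.eval_finsetSum, Polynomial.eval_monomial]
  refine Finset.sum_congr rfl fun k hk => ?_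
  rw [laguerreCoeff, if_pos (by simpa [Nat.lt_succ_iff] using hk)]
  ring

lemma laguerreCoeff_succ (n : ℕ) (α : ℝ) (k : ℕ) :
    (k + 1 : ℝ) * (k + 1 + α) * laguerreCoeff n α (k + 1)
      + (n - k : ℝ) * laguerreCoeff n α k = 0 := by
  rcases lt_trichotomy k n with h | rfl | h
  · obtain ⟨m, rfl⟩ : ∃ m, n = k + 1 + m := ⟨n - (k + 1), by omega⟩
    rw [laguerreCoeff, laguerreCoeff, if_pos (by omega), if_pos (by omega),
      show k + 1 + m - (k + 1) = m by omega, show k + 1 + m - k = m + 1 by omega]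
    have h1 := genBinom_succ (((k + 1 + m : ℕ) : ℝ) + α) m
    have h : (Nat.factorial k : ℝ) ≠ 0 := by positivity
    rw [Nat.factorial_succ]
    push_cast at h1 ⊢
    field_simp
    rw [pow_succ]
    linear_combination (-1) ^ k * h1
  · rw [laguerreCoeff, if_neg (by omega)]
    simp
  · rw [laguerreCoeff, laguerreCoeff, if_neg (by omega), if_neg (by omega)]
    simp

lemma laguerrePoly_ode (n : ℕ) (α : ℝ) :
    Polynomial.X * (laguerrePoly n α).derivative.derivative
      + Polynomial.C (α + 1) * (laguerrePoly n α).derivative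
      - Polynomial.X * (laguerrePoly n α).derivative
      + Polynomial.C (n : ℝ) * laguerrePoly n α = 0 := by
  ext k
  have h := laguerreCoeff_succ n α k
  cases k with
  | zero =>
    simp only [Polynomial.coeff_add, Polynomial.coeff_sub, Polynomial.coeff_C_mul,
      Polynomial.coeff_X_mul_zero, Polynomial.coeff_derivative, coeff_laguerrePoly,
      Polynomial.coeff_zero]
    push_cast at h ⊢
    linear_combination h
  | succ k =>
    simp only [Polynomial.coeff_add, Polynomial.coeff_sub, Polynomial.coeff_C_mul,
      Polynomial.coeff_X_mul, Polynomial.coeff_derivative, coeff_laguerrePoly,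
      Polynomial.coeff_zero]
    push_cast at h ⊢
    linear_combination h

lemma laguerrePoly_ne_zero (n : ℕ) (α : ℝ) : laguerrePoly n α ≠ 0 := by
  intro h
  have h1 := coeff_laguerrePoly n α n
  rw [h, laguerreCoeff, if_pos le_rfl] at h1
  have : (Nat.factorial n : ℝ) ≠ 0 := by positivity
  simp only [Polynomial.coeff_zero, genBinom, Nat.sub_self, Finset.range_zero, Finset.prod_empty,
    Nat.factorial_zero, Nat.cast_one, div_one, mul_one] at h1
  exact div_ne_zero (pow_ne_zero n (by norm_num)) this h1.symm

lemma natDegree_laguerrePoly_le (n : ℕ) (α : ℝ) : (laguerrePoly n α).natDegree ≤ n := by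
  rw [Polynomial.natDegree_le_iff_coeff_eq_zero]
  intro k hk
  rw [coeff_laguerrePoly, laguerreCoeff, if_neg (by omega)]

lemma setOf_laguerreL_eq_zero (n : ℕ) (α : ℝ) :
    {x : ℝ | laguerreL n α x = 0} = (laguerrePoly n α).roots.toFinset := by
  ext x
  simp [laguerrePoly_ne_zero, eval_laguerrePoly]

lemma finite_laguerreL_zeros (n : ℕ) (α : ℝ) : {x : ℝ | laguerreL n α x = 0}.Finite := by
  rw [setOf_laguerreL_eq_zero]
  exact Finset.finite_toSet _

lemma ncard_laguerreL_zeros_le (n : ℕ) (α : ℝ) :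
    {x : ℝ | laguerreL n α x = 0}.ncard ≤ n := by
  rw [setOf_laguerreL_eq_zero, Set.ncard_coe_finset]
  exact (Multiset.toFinset_card_le _).trans
    ((Polynomial.card_roots' _).trans (natDegree_laguerrePoly_le n α))

/-- The potential of the Laguerre equation in Liouville normal form `u'' + q u = 0`. -/
noncomputable def laguerrePotential (n : ℕ) (α x : ℝ) : ℝ :=
  -1 / 4 + (2 * n + α + 1) / (2 * x) + (1 - α ^ 2) / (4 * x ^ 2)

lemma hasDerivAt_laguerre_wronskian (n : ℕ) (α ω c x : ℝ) (hx : 0 < x) :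
    HasDerivAt (fun y : ℝ => Real.exp (-y / 2) * y ^ ((α + 1) / 2) *
      (((laguerrePoly n α).derivative.eval y
          + ((α + 1) / 2 / y - 1 / 2) * (laguerrePoly n α).eval y) * Real.sin (ω * (y - c))
        - (laguerrePoly n α).eval y * (ω * Real.cos (ω * (y - c)))))
      (Real.exp (-x / 2) * x ^ ((α + 1) / 2) * ((ω ^ 2 - laguerrePotential n α x) *
        (laguerrePoly n α).eval x * Real.sin (ω * (x - c)))) x := by
  set P := laguerrePoly n α with hP
  have hode : x * P.derivative.derivative.eval x + (α + 1) * P.derivative.eval x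
      - x * P.derivative.eval x + n * P.eval x = 0 := by
    have := congrArg (Polynomial.eval x) (laguerrePoly_ode n α)
    simpa using this
  have he : HasDerivAt (fun y : ℝ => Real.exp (-y / 2)) (Real.exp (-x / 2) * (-1 / 2)) x :=
    ((hasDerivAt_id x).neg.div_const 2).exp
  have hp : HasDerivAt (fun y : ℝ => y ^ ((α + 1) / 2))
      (x ^ ((α + 1) / 2) * ((α + 1) / 2 / x)) x := by
    have := Real.hasDerivAt_rpow_const (p := (α + 1) / 2) (Or.inl hx.ne')
    rw [Real.rpow_sub_one hx.ne'] at this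
    refine this.congr_deriv ?_
    ring
  have hi : HasDerivAt (fun y : ℝ => (α + 1) / 2 / y - 1 / 2) (-((α + 1) / 2) / x ^ 2) x := by
    have := ((hasDerivAt_inv hx.ne').const_mul ((α + 1) / 2)).sub_const (1 / 2)
    simp only [← div_eq_mul_inv] at this
    refine this.congr_deriv ?_
    ring
  have hl : HasDerivAt (fun y : ℝ => ω * (y - c)) ω x := by
    simpa using ((hasDerivAt_id x).sub_const c).const_mul ω
  have hs := hl.sin
  have hc := (hl.cos).const_mul ω
  have h := (he.mul hp).mul ((((P.derivative.hasDerivAt x).add (hi.mul (P.hasDerivAt x))).mul hs).sub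
    ((P.hasDerivAt x).mul hc))
  refine h.congr_deriv ?_
  simp only [laguerrePotential, Pi.mul_apply, Pi.add_apply, Pi.sub_apply]
  have hx0 := hx.ne'
  set S := Real.sin (ω * (x - c))
  set C := Real.cos (ω * (x - c))
  set E := Real.exp (-x / 2)
  set R := x ^ ((α + 1) / 2)
  have h2 : P.derivative.derivative.eval x =
      -((α + 1) * P.derivative.eval x - x * P.derivative.eval x + n * P.eval x) / x := by
    field_simp
    linear_combination hode
  rw [h2]
  field_simp
  ring

lemma exists_laguerreL_zero (n : ℕ) (α ω c : ℝ) (hc : 0 < c) (hω : 0 < ω)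
    (hq : ∀ x ∈ Set.Icc c (c + Real.pi / ω), ω ^ 2 ≤ laguerrePotential n α x) :
    ∃ x ∈ Set.Ioc c (c + Real.pi / ω), laguerreL n α x = 0 := by
  by_contra! hno
  have hL : 0 < Real.pi / ω := div_pos Real.pi_pos hω
  set d := c + Real.pi / ω with hd
  set P := laguerrePoly n α with hP
  have hno' : ∀ x ∈ Set.Ioc c d, P.eval x ≠ 0 := fun x hx => by
    rw [hP, eval_laguerrePoly]; exact hno x hx
  obtain ⟨σ, hσ⟩ : ∃ σ : ℝ, ∀ x ∈ Set.Ioc c d, 0 < σ * P.eval x := by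
    have hdmem : d ∈ Set.Ioc c d := ⟨by linarith, le_rfl⟩
    refine ⟨P.eval d, fun x hx => ?_⟩
    by_contra! hneg
    have hcont : ContinuousOn (fun y => P.eval d * P.eval y) (Set.Icc x d) :=
      (continuous_const.mul P.continuous).continuousOn
    have hmem : (0 : ℝ) ∈ Set.Icc (P.eval d * P.eval x) (P.eval d * P.eval d) :=
      ⟨hneg, mul_self_nonneg _⟩
    obtain ⟨y, hy, hy0⟩ := intermediate_value_Icc hx.2 hcont hmem
    exact mul_ne_zero (hno' d hdmem) (hno' y ⟨hx.1.trans_le hy.1, hy.2⟩) hy0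
  have hσc : 0 ≤ σ * P.eval c := by
    have hcl : c ∈ closure (Set.Ioc c d) := by
      rw [closure_Ioc (by linarith : c ≠ d)]; exact ⟨le_rfl, by linarith⟩
    have : IsClosed {x | 0 ≤ σ * P.eval x} :=
      isClosed_le continuous_const (continuous_const.mul P.continuous)
    exact this.closure_subset_iff.2 (fun x hx => (hσ x hx).le) hcl
  have hder := fun x (hx : x ∈ Set.Icc c d) =>
    (hasDerivAt_laguerre_wronskian n α ω c x (hc.trans_le hx.1)).const_mul σ
  have hanti := antitoneOn_of_hasDerivWithinAt_nonpos (convex_Icc c d)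
    (fun x hx => (hder x hx).continuousAt.continuousWithinAt)
    (fun x hx => (hder x (interior_subset hx)).hasDerivWithinAt) (fun x hx => by
      rw [interior_Icc] at hx
      have h1 := hσ x ⟨hx.1, hx.2.le⟩
      have h2 : 0 ≤ Real.sin (ω * (x - c)) := by
        apply Real.sin_nonneg_of_nonneg_of_le_pi
        · exact mul_nonneg hω.le (by linarith [hx.1])
        · have : ω * (x - c) ≤ ω * (Real.pi / ω) :=
            mul_le_mul_of_nonneg_left (by linarith [hx.2]) hω.le
          rwa [mul_div_cancel₀ _ hω.ne'] at this
      have h3 := hq x ⟨hx.1.le, hx.2.le⟩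
      have h4 : 0 ≤ Real.exp (-x / 2) * x ^ ((α + 1) / 2) :=
        mul_nonneg (Real.exp_pos _).le (Real.rpow_nonneg (hc.trans hx.1).le _)
      have h5 : 0 ≤ (Real.exp (-x / 2) * x ^ ((α + 1) / 2)) *
          ((laguerrePotential n α x - ω ^ 2) * (σ * P.eval x) * Real.sin (ω * (x - c))) :=
        mul_nonneg h4 (mul_nonneg (mul_nonneg (by linarith) h1.le) h2)
      linarith)
  have hle := hanti (Set.left_mem_Icc.2 (by linarith)) (Set.right_mem_Icc.2 (by linarith))
    (by linarith : c ≤ d)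
  have hdc : ω * (d - c) = Real.pi := by rw [hd]; field_simp; ring
  simp only [hdc, sub_self, mul_zero, Real.sin_zero, Real.cos_zero, Real.sin_pi, Real.cos_pi]
    at hle
  have hgc : 0 < Real.exp (-c / 2) * c ^ ((α + 1) / 2) :=
    mul_pos (Real.exp_pos _) (Real.rpow_pos_of_pos hc _)
  have hgd : 0 < Real.exp (-d / 2) * d ^ ((α + 1) / 2) :=
    mul_pos (Real.exp_pos _) (Real.rpow_pos_of_pos (by linarith) _)
  have h1 := mul_nonneg (mul_nonneg hgc.le hω.le) hσc
  have h2 := mul_pos (mul_pos hgd hω) (hσ d ⟨by linarith, le_rfl⟩)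
  linarith

lemma ncard_inter_Ioc_add {S : Set ℝ} (hS : S.Finite) {a b c : ℝ} (hab : a ≤ b) (hbc : b ≤ c) :
    (S ∩ Set.Ioc a c).ncard = (S ∩ Set.Ioc a b).ncard + (S ∩ Set.Ioc b c).ncard := by
  rw [← Set.Ioc_union_Ioc_eq_Ioc hab hbc, Set.inter_union_distrib_left,
    Set.ncard_union_eq _ (hS.inter_of_left _) (hS.inter_of_left _)]
  exact (Set.Ioc_disjoint_Ioc_of_le le_rfl).mono Set.inter_subset_right Set.inter_subset_right

lemma le_ncard_inter_Ioc {S : Set ℝ} (hS : S.Finite) {c h : ℝ} (hh : 0 ≤ h) (K : ℕ)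
    (hz : ∀ j < K, ∃ x ∈ Set.Ioc (c + j * h) (c + j * h + h), x ∈ S) :
    K ≤ (S ∩ Set.Ioc c (c + K * h)).ncard := by
  induction K with
  | zero => simp
  | succ K ih =>
    have h1 : c + ((K + 1 : ℕ) : ℝ) * h = c + K * h + h := by push_cast; ring
    have hK : 0 ≤ (K : ℝ) * h := by positivity
    rw [h1, ncard_inter_Ioc_add hS (by linarith : c ≤ c + K * h) (by linarith)]
    refine add_le_add (ih fun j hj => hz j (by omega)) ?_
    obtain ⟨x, hx, hxS⟩ := hz K (by omega)
    exact Nat.one_le_iff_ne_zero.2 ((Set.ncard_pos (hS.inter_of_left _)).2 ⟨x, hxS, hx⟩).ne'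

lemma le_ncard_laguerreL_zeros_Ioc (n : ℕ) (α ω c d : ℝ) (hc : 0 < c) (hω : 0 < ω) (hcd : c ≤ d)
    (hq : ∀ x ∈ Set.Icc c d, ω ^ 2 ≤ laguerrePotential n α x) :
    ω * (d - c) / Real.pi - 1 ≤ (({x : ℝ | laguerreL n α x = 0} ∩ Set.Ioc c d).ncard : ℝ) := by
  have hL : 0 < Real.pi / ω := div_pos Real.pi_pos hω
  set K := ⌊ω * (d - c) / Real.pi⌋₊ with hK
  have hKle : (K : ℝ) ≤ ω * (d - c) / Real.pi :=
    Nat.floor_le (div_nonneg (mul_nonneg hω.le (by linarith)) Real.pi_pos.le)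
  have hKlt : ω * (d - c) / Real.pi < K + 1 := Nat.lt_floor_add_one _
  have hKd : (K : ℝ) * (Real.pi / ω) ≤ d - c := by
    calc (K : ℝ) * (Real.pi / ω) ≤ ω * (d - c) / Real.pi * (Real.pi / ω) :=
          mul_le_mul_of_nonneg_right hKle hL.le
      _ = d - c := by field_simp
  have hfin := finite_laguerreL_zeros n α
  have h1 := le_ncard_inter_Ioc hfin (c := c) hL.le K (fun j hj => by
    have hj0 : 0 ≤ (j : ℝ) * (Real.pi / ω) := by positivity
    have hj1 : ((j : ℝ) + 1) * (Real.pi / ω) ≤ K * (Real.pi / ω) :=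
      mul_le_mul_of_nonneg_right (by exact_mod_cast hj) hL.le
    exact exists_laguerreL_zero n α ω _ (by linarith) hω fun x hx =>
      hq x ⟨by linarith [hx.1], by linarith [hx.2]⟩)
  have h2 : ({x : ℝ | laguerreL n α x = 0} ∩ Set.Ioc c (c + K * (Real.pi / ω))).ncard ≤
      ({x : ℝ | laguerreL n α x = 0} ∩ Set.Ioc c d).ncard :=
    Set.ncard_le_ncard (Set.inter_subset_inter_right _ (Set.Ioc_subset_Ioc_right (by linarith)))
      (hfin.inter_of_left _)
  have h3 : (K : ℝ) ≤ (({x : ℝ | laguerreL n α x = 0} ∩ Set.Ioc c d).ncard : ℝ) := by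
    exact_mod_cast h1.trans h2
  linarith

lemma integral_sqrt_div (r1 r2 b : ℝ) (h1 : 0 ≤ r1) (h12 : r1 < r2) (hb : 0 ≤ b)
    (hbr : r1 * r2 = b ^ 2) :
    IntervalIntegrable (fun x => Real.sqrt ((r2 - x) * (x - r1)) / x) MeasureTheory.volume r1 r2 ∧
      ∫ x in r1..r2, Real.sqrt ((r2 - x) * (x - r1)) / x = Real.pi * ((r1 + r2) / 2 - b) := by
  have hδ : 0 < r2 - r1 := by linarith
  set A : ℝ → ℝ := fun x => Real.sqrt ((r2 - x) * (x - r1))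
    + (r1 + r2) / 2 * Real.arcsin ((2 * x - (r1 + r2)) / (r2 - r1)) with hA
  set B : ℝ → ℝ := fun x =>
    b * Real.arcsin (((r1 + r2) * x - 2 * b ^ 2) / (x * (r2 - r1))) with hB
  have hr1 : 0 < b → 0 < r1 := fun hb' => by
    rcases h1.eq_or_lt with h | h
    · rw [← h, zero_mul] at hbr
      exact absurd hbr (by positivity)
    · exact h
  have hAc : Continuous A := by fun_prop
  have hBc : ContinuousOn B (Set.Icc r1 r2) := by
    rcases hb.eq_or_lt with h | h
    · simp only [hB, ← h, zero_mul]
      exact continuousOn_const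
    · refine continuousOn_const.mul (Real.continuous_arcsin.comp_continuousOn
        (ContinuousOn.div (by fun_prop) (by fun_prop) fun x hx => ?_))
      exact mul_ne_zero ((hr1 h).trans_le hx.1).ne' hδ.ne'
  have hder : ∀ x ∈ Set.Ioo r1 r2,
      HasDerivAt (A - B) (Real.sqrt ((r2 - x) * (x - r1)) / x) x := by
    intro x hx
    have hx0 : 0 < x := h1.trans_lt hx.1
    have hpos : 0 < (r2 - x) * (x - r1) := mul_pos (by linarith [hx.2]) (by linarith [hx.1])
    set S := Real.sqrt ((r2 - x) * (x - r1)) with hS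
    have hS0 : 0 < S := Real.sqrt_pos.2 hpos
    have hSS : S ^ 2 = (r2 - x) * (x - r1) := Real.sq_sqrt hpos.le
    have hd1 : HasDerivAt (fun x => Real.sqrt ((r2 - x) * (x - r1)))
        ((r1 + r2 - 2 * x) / (2 * S)) x := by
      have := (((hasDerivAt_id x).const_sub r2).mul ((hasDerivAt_id x).sub_const r1)).sqrt
        (by simpa using hpos.ne')
      refine this.congr_deriv ?_
      simp only [id, Pi.mul_apply, ← hS]
      ring
    have harc : ∀ u v : ℝ, 0 < v → 1 - u ^ 2 = v ^ 2 → HasDerivAt Real.arcsin (1 / v) u := by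
      intro u v hv huv
      have hlt : u ^ 2 < 1 := by nlinarith [pow_pos hv 2]
      have := Real.hasDerivAt_arcsin (x := u) (by rintro rfl; norm_num at hlt)
        (by rintro rfl; norm_num at hlt)
      rwa [huv, Real.sqrt_sq hv.le] at this
    have hd2 : HasDerivAt (fun x => Real.arcsin ((2 * x - (r1 + r2)) / (r2 - r1))) (1 / S) x := by
      have hi : HasDerivAt (fun x => (2 * x - (r1 + r2)) / (r2 - r1)) (2 / (r2 - r1)) x := by
        simpa using (((hasDerivAt_id x).const_mul 2).sub_const (r1 + r2)).div_const (r2 - r1)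
      refine ((harc _ (2 * S / (r2 - r1)) (by positivity) ?_).comp x hi).congr_deriv ?_
      · rw [div_pow, div_pow, mul_pow, hSS]
        field_simp
        ring
      · field_simp
    have hd3 : HasDerivAt B (b ^ 2 / (x * S)) x := by
      rcases hb.eq_or_lt with h | h
      · simp only [hB, ← h, zero_mul]
        simpa using hasDerivAt_const x (0 : ℝ)
      · have hi : HasDerivAt (fun x => ((r1 + r2) * x - 2 * b ^ 2) / (x * (r2 - r1)))
            (2 * b ^ 2 / (x ^ 2 * (r2 - r1))) x := by
          have := (((hasDerivAt_id x).const_mul (r1 + r2)).sub_const (2 * b ^ 2)).div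
            ((hasDerivAt_id x).mul_const (r2 - r1)) (by simp only [id]; positivity)
          refine this.congr_deriv ?_
          simp only [id]
          field_simp
          ring
        refine (((harc _ (2 * b * S / (x * (r2 - r1))) (by positivity) ?_).comp x hi).const_mul
          b).congr_deriv ?_
        · rw [div_pow, div_pow, mul_pow x, mul_pow (2 * b), hSS]
          field_simp
          linear_combination (4 * b ^ 2 - 4 * x ^ 2) * hbr
        · field_simp
    refine ((hd1.add (hd2.const_mul ((r1 + r2) / 2))).sub hd3).congr_deriv ?_
    field_simp
    linear_combination (-2 : ℝ) * hSS + 2 * hbr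
  have hcont : ContinuousOn (A - B) (Set.Icc r1 r2) := hAc.continuousOn.sub hBc
  have hint : IntervalIntegrable (fun x => Real.sqrt ((r2 - x) * (x - r1)) / x)
      MeasureTheory.volume r1 r2 := by
    refine intervalIntegral.intervalIntegrable_deriv_of_nonneg (g := A - B) ?_ ?_ ?_
    · rwa [Set.uIcc_of_le h12.le]
    · rwa [min_eq_left h12.le, max_eq_right h12.le]
    · rw [min_eq_left h12.le, max_eq_right h12.le]
      exact fun x hx => div_nonneg (Real.sqrt_nonneg _) (h1.trans hx.1.le)
  refine ⟨hint, ?_⟩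
  rw [intervalIntegral.integral_eq_sub_of_hasDerivAt_of_le h12.le hcont hder hint]
  have e1 : (2 * r2 - (r1 + r2)) / (r2 - r1) = 1 := by rw [div_eq_one_iff_eq hδ.ne']; ring
  have e2 : (2 * r1 - (r1 + r2)) / (r2 - r1) = -1 := by rw [div_eq_iff hδ.ne']; ring
  have hB2 : B r2 = b * (Real.pi / 2) := by
    have h0 : r2 * (r2 - r1) ≠ 0 := mul_ne_zero (by linarith) hδ.ne'
    have : ((r1 + r2) * r2 - 2 * b ^ 2) / (r2 * (r2 - r1)) = 1 := by
      rw [div_eq_one_iff_eq h0, ← hbr]; ring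
    simp only [hB, this, Real.arcsin_one]
  have hB1 : B r1 = -(b * (Real.pi / 2)) := by
    rcases hb.eq_or_lt with h | h
    · simp [hB, ← h]
    · have h0 : r1 * (r2 - r1) ≠ 0 := mul_ne_zero (hr1 h).ne' hδ.ne'
      have : ((r1 + r2) * r1 - 2 * b ^ 2) / (r1 * (r2 - r1)) = -1 := by
        rw [div_eq_iff h0, ← hbr]; ring
      simp only [hB, this, Real.arcsin_neg_one]
      ring
  simp only [Pi.sub_apply, hB1, hB2, hA, e1, e2, Real.arcsin_one, Real.arcsin_neg_one, sub_self,
    zero_mul, mul_zero, Real.sqrt_zero]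
  ring

lemma eventually_le_laguerrePotential {α : ℕ → ℝ} {a : ℝ}
    (hα : Tendsto (fun n : ℕ => α n / n) atTop (𝓝 a)) {s δ : ℝ} (hs : 0 < s) (hδ : 0 < δ) :
    ∀ᶠ n : ℕ in atTop, ∀ x, s ≤ x →
      (2 * (2 + a) * x - x ^ 2 - a ^ 2) / (4 * x ^ 2) - δ
        ≤ laguerrePotential n (α n) (n * x) := by
  have h0 : Tendsto (fun n : ℕ => (1 : ℝ) / n) atTop (𝓝 0) := tendsto_one_div_atTop_nhds_zero_nat
  have hlim : Tendsto (fun n : ℕ => |α n / n + 1 / n - a| / (2 * s)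
      + |1 / (n : ℝ) * (1 / n) - (α n / n) ^ 2 + a ^ 2| / (4 * s ^ 2)) atTop (𝓝 0) := by
    have := ((((hα.add h0).sub_const a).abs).div_const (2 * s)).add
      (((((h0.mul h0).sub (hα.pow 2)).add_const (a ^ 2)).abs).div_const (4 * s ^ 2))
    simpa using this
  filter_upwards [hlim.eventually (gt_mem_nhds hδ), eventually_gt_atTop 0] with n hn hn0 x hx
  have hx0 : 0 < x := hs.trans_le hx
  have hn0' : (0 : ℝ) < n := by exact_mod_cast hn0
  set u := α n / n + 1 / n - a with hu
  set v := 1 / (n : ℝ) * (1 / n) - (α n / n) ^ 2 + a ^ 2 with hv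
  have e : laguerrePotential n (α n) (n * x)
      = (2 * (2 + a) * x - x ^ 2 - a ^ 2) / (4 * x ^ 2) + u / (2 * x) + v / (4 * x ^ 2) := by
    rw [laguerrePotential, hu, hv]
    field_simp
    ring
  have h1 : -(|u| / (2 * s)) ≤ u / (2 * x) := by
    have : |u / (2 * x)| ≤ |u| / (2 * s) := by
      rw [abs_div, abs_of_pos (by positivity : 0 < 2 * x)]
      gcongr
    linarith [neg_abs_le (u / (2 * x))]
  have h2 : -(|v| / (4 * s ^ 2)) ≤ v / (4 * x ^ 2) := by
    have : |v / (4 * x ^ 2)| ≤ |v| / (4 * s ^ 2) := by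
      rw [abs_div, abs_of_pos (by positivity : 0 < 4 * x ^ 2)]
      gcongr
    linarith [neg_abs_le (v / (4 * x ^ 2))]
  rw [e]
  linarith

section Asymptotics

variable {α : ℕ → ℝ} {a r1 r2 : ℝ}

lemma eventually_le_ncard_of_le_density
    (hα : Tendsto (fun n : ℕ => α n / n) atTop (𝓝 a)) (hsum : r1 + r2 = 2 * (2 + a))
    (hprod : r1 * r2 = a ^ 2) {s t m η : ℝ} (hs : 0 < s) (hst : s ≤ t) (hη : 0 < η)
    (hm : ∀ x ∈ Set.Icc s t, m ≤ Real.sqrt ((r2 - x) * (x - r1)) / x) :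
    ∀ᶠ n : ℕ in atTop, (n : ℝ) * ((m - η) / 2) * (t - s) / Real.pi - 1 ≤
      (({x : ℝ | laguerreL n (α n) x = 0} ∩ Set.Ioc (n * s) (n * t)).ncard : ℝ) := by
  rcases le_or_gt m η with hmη | hmη
  · refine Eventually.of_forall fun n => ?_
    have : 0 ≤ (n : ℝ) * ((η - m) / 2) * (t - s) / Real.pi :=
      div_nonneg (mul_nonneg (mul_nonneg n.cast_nonneg (by linarith)) (by linarith))
        Real.pi_pos.le
    have h2 : (n : ℝ) * ((m - η) / 2) * (t - s) / Real.pi =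
        -((n : ℝ) * ((η - m) / 2) * (t - s) / Real.pi) := by ring
    rw [h2]
    have h3 : (0 : ℝ) ≤
      (({x : ℝ | laguerreL n (α n) x = 0} ∩ Set.Ioc (n * s) (n * t)).ncard : ℝ) := Nat.cast_nonneg _
    linarith
  · set ω := (m - η) / 2 with hω
    have hω0 : 0 < ω := by rw [hω]; linarith
    have hδ : 0 < (m / 2) ^ 2 - ω ^ 2 := by
      rw [hω]; nlinarith
    filter_upwards [eventually_le_laguerrePotential hα hs hδ, eventually_gt_atTop 0]
      with n hn hn0
    have hn0' : (0 : ℝ) < n := by exact_mod_cast hn0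
    have h := le_ncard_laguerreL_zeros_Ioc n (α n) ω (n * s) (n * t) (by positivity) hω0
      (by gcongr) (fun y hy => by
        obtain ⟨x, rfl⟩ : ∃ x, y = n * x := ⟨y / n, by field_simp⟩
        have hx1 : s ≤ x := le_of_mul_le_mul_left hy.1 hn0'
        have hx2 : x ≤ t := le_of_mul_le_mul_left hy.2 hn0'
        have hx0 : 0 < x := hs.trans_le hx1
        have hmx := hm x ⟨hx1, hx2⟩
        have hm0 : 0 < m := hη.trans hmη
        have hSpos : 0 < Real.sqrt ((r2 - x) * (x - r1)) :=
          (div_pos_iff_of_pos_right hx0).1 (hm0.trans_le hmx)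
        have hsq : m ^ 2 ≤ (r2 - x) * (x - r1) / x ^ 2 := by
          have := pow_le_pow_left₀ hm0.le hmx 2
          rwa [div_pow, Real.sq_sqrt (Real.sqrt_pos.1 hSpos).le] at this
        have e : (2 * (2 + a) * x - x ^ 2 - a ^ 2) / (4 * x ^ 2)
            = (r2 - x) * (x - r1) / x ^ 2 / 4 := by
          rw [← hsum, ← hprod]
          field_simp
          ring
        have := hn x hx1
        rw [e] at this
        linarith)
    convert h using 2
    ring

lemma eventually_le_ncard_of_pos
    (hα : Tendsto (fun n : ℕ => α n / n) atTop (𝓝 a)) (hsum : r1 + r2 = 2 * (2 + a))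
    (hprod : r1 * r2 = a ^ 2) {s t ε : ℝ} (hs : 0 < s) (hst : s < t) (hε : 0 < ε) :
    ∀ᶠ n : ℕ in atTop,
      (n : ℝ) * (1 / (2 * Real.pi) * (∫ x in s..t, Real.sqrt ((r2 - x) * (x - r1)) / x) - ε) ≤
      (({x : ℝ | laguerreL n (α n) x = 0} ∩ Set.Ioc (n * s) (n * t)).ncard : ℝ) := by
  set f : ℝ → ℝ := fun x => Real.sqrt ((r2 - x) * (x - r1)) / x with hf
  have hfc : ContinuousOn f (Set.Icc s t) :=
    ContinuousOn.div (by fun_prop) (by fun_prop) fun x hx => (hs.trans_le hx.1).ne'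
  have hfi : ∀ x ∈ Set.Icc s t, ∀ y ∈ Set.Icc s t,
      IntervalIntegrable f MeasureTheory.volume x y := fun x hx y hy =>
    (hfc.mono (Set.uIcc_subset_Icc hx hy)).intervalIntegrable
  set η := ε / (t - s) with hη
  have hts : 0 < t - s := by linarith
  have hη0 : 0 < η := div_pos hε hts
  obtain ⟨δ, hδ, huc⟩ := Metric.uniformContinuousOn_iff.1
    (isCompact_Icc.uniformContinuousOn_of_continuous hfc) η hη0
  obtain ⟨K, hK⟩ := exists_nat_gt ((t - s) / δ)
  have hK0 : (0 : ℝ) < K := (div_pos hts hδ).trans hK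
  set h := (t - s) / K with hh
  have hh0 : 0 < h := div_pos hts hK0
  have hhδ : h < δ := by
    rw [hh, div_lt_iff₀ hK0]
    rw [div_lt_iff₀ hδ] at hK
    linarith
  have hKh : (K : ℝ) * h = t - s := by rw [hh]; field_simp
  have hpi := Real.pi_gt_three
  have hpi0 := Real.pi_pos
  have step : ∀ x, s ≤ x → x + h ≤ t → ∀ᶠ n : ℕ in atTop,
      (n : ℝ) * (1 / (2 * Real.pi) * (∫ y in x..(x + h), f y) - η * h) ≤
      (({x : ℝ | laguerreL n (α n) x = 0} ∩ Set.Ioc (n * x) (n * (x + h))).ncard : ℝ) := by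
    intro x hx hxt
    have hosc : ∀ y ∈ Set.Icc x (x + h), |f y - f x| < η := fun y hy => by
      have := huc y ⟨hx.trans hy.1, hy.2.trans hxt⟩ x ⟨hx, by linarith⟩
        (by rw [Real.dist_eq, abs_of_nonneg (by linarith [hy.1])]; linarith [hy.2])
      rwa [Real.dist_eq] at this
    have hint : (∫ y in x..(x + h), f y) ≤ (f x + η) * h := by
      have := intervalIntegral.integral_mono_on (by linarith : x ≤ x + h)
        (hfi x ⟨hx, by linarith⟩ (x + h) ⟨by linarith, hxt⟩)
        (intervalIntegrable_const (c := f x + η))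
        (fun y hy => by linarith [(abs_lt.1 (hosc y hy)).2])
      rw [intervalIntegral.integral_const, smul_eq_mul] at this
      linarith
    have hlow := eventually_le_ncard_of_le_density hα hsum hprod (m := f x - η)
      (hs.trans_le hx) (by linarith : x ≤ x + h) hη0
      (fun y hy => by
        have := (abs_lt.1 (hosc y hy)).1
        simp only [hf] at this ⊢
        linarith)
    have hbig : ∀ᶠ n : ℕ in atTop, 2 / (η * h) ≤ (n : ℝ) :=
      tendsto_natCast_atTop_atTop.eventually_ge_atTop _
    filter_upwards [hlow, hbig] with n hn hn2
    refine le_trans ?_ hn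
    have hηh : 0 < η * h := by positivity
    rw [div_le_iff₀ hηh] at hn2
    have e1 : (n : ℝ) * ((f x - η - η) / 2) * (x + h - x) / Real.pi
        = (n : ℝ) * (1 / (2 * Real.pi) * ((f x + η) * h)) - n * (η * h) * (3 / (2 * Real.pi)) := by
      field_simp
      ring
    have e2 : 3 / (2 * Real.pi) ≤ 1 / 2 := by
      rw [div_le_div_iff₀ (by positivity) (by norm_num)]
      linarith
    have e3 : (n : ℝ) * (1 / (2 * Real.pi) * ∫ y in x..(x + h), f y)
        ≤ (n : ℝ) * (1 / (2 * Real.pi) * ((f x + η) * h)) := by gcongr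
    have e4 : n * (η * h) * (3 / (2 * Real.pi)) ≤ n * (η * h) * (1 / 2) := by gcongr
    rw [e1]
    linarith
  have ind : ∀ k : ℕ, k ≤ K → ∀ᶠ n : ℕ in atTop,
      (n : ℝ) * (1 / (2 * Real.pi) * (∫ y in s..(s + k * h), f y) - η * (k * h)) ≤
      (({x : ℝ | laguerreL n (α n) x = 0} ∩ Set.Ioc (n * s) (n * (s + k * h))).ncard : ℝ) := by
    intro k
    induction k with
    | zero => intro _; simp
    | succ k ih =>
      intro hk
      have hkh : 0 ≤ (k : ℝ) * h := by positivity
      have hk1 : s + ((k + 1 : ℕ) : ℝ) * h = s + k * h + h := by push_cast; ring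
      have hkt : s + k * h + h ≤ t := by
        have : ((k + 1 : ℕ) : ℝ) * h ≤ K * h := by gcongr
        linarith
      filter_upwards [ih (by omega), step (s + k * h) (by linarith) hkt] with n h1 h2
      rw [hk1, ncard_inter_Ioc_add (finite_laguerreL_zeros n (α n))
        (mul_le_mul_of_nonneg_left (by linarith) n.cast_nonneg : (n : ℝ) * s ≤ n * (s + k * h))
        (mul_le_mul_of_nonneg_left (by linarith) n.cast_nonneg),
        ← intervalIntegral.integral_add_adjacent_intervals
          (hfi s ⟨le_rfl, hst.le⟩ (s + k * h) ⟨by linarith, by linarith⟩)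
          (hfi (s + k * h) ⟨by linarith, by linarith⟩ _ ⟨by linarith, hkt⟩)]
      push_cast
      linarith
  have hfinal := ind K le_rfl
  rw [hKh, show s + (t - s) = t by ring, show η * (t - s) = ε by rw [hη]; field_simp] at hfinal
  exact hfinal

lemma eventually_le_ncard (hα : Tendsto (fun n : ℕ => α n / n) atTop (𝓝 a))
    (hsum : r1 + r2 = 2 * (2 + a)) (hprod : r1 * r2 = a ^ 2) (h1 : 0 ≤ r1)
    (hint : IntervalIntegrable (fun x => Real.sqrt ((r2 - x) * (x - r1)) / x)
      MeasureTheory.volume r1 r2)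
    {s t ε : ℝ} (hs : r1 ≤ s) (hst : s ≤ t) (ht : t ≤ r2) (hε : 0 < ε) :
    ∀ᶠ n : ℕ in atTop,
      (n : ℝ) * (1 / (2 * Real.pi) * (∫ x in s..t, Real.sqrt ((r2 - x) * (x - r1)) / x) - ε) ≤
      (({x : ℝ | laguerreL n (α n) x = 0} ∩ Set.Ioc (n * s) (n * t)).ncard : ℝ) := by
  rcases hst.eq_or_lt with rfl | hst
  · refine Eventually.of_forall fun n => ?_
    have : 0 ≤ (n : ℝ) * ε := by positivity
    simp only [intervalIntegral.integral_same, mul_zero, zero_sub, mul_neg, Set.Ioc_self,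
      Set.inter_empty, Set.ncard_empty, Nat.cast_zero]
    linarith
  set f : ℝ → ℝ := fun x => Real.sqrt ((r2 - x) * (x - r1)) / x with hf
  have hint' : IntervalIntegrable f MeasureTheory.volume s t := by
    refine hint.mono_set ?_
    rw [Set.uIcc_of_le hst.le, Set.uIcc_of_le (by linarith)]
    exact Set.Icc_subset_Icc hs ht
  have hcont : ContinuousOn (fun u => ∫ x in u..t, f x) (Set.Icc s t) := by
    have := intervalIntegral.continuousOn_primitive_interval_left
      (f := f) (a := s) (b := t) (μ := MeasureTheory.volume)
      ((intervalIntegrable_iff_integrableOn_Icc_of_le hst.le).1 hint' |>.mono_set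
        (Set.uIcc_of_le hst.le).subset)
    rwa [Set.uIcc_of_le hst.le] at this
  have hlim : Tendsto (fun u => 1 / (2 * Real.pi) * ∫ x in u..t, f x) (𝓝[>] s)
      (𝓝 (1 / (2 * Real.pi) * ∫ x in s..t, f x)) :=
    (((hcont s ⟨le_rfl, hst.le⟩).mono_of_mem_nhdsWithin
      (Icc_mem_nhdsGT hst)).tendsto).const_mul _
  obtain ⟨u, hu, hsu, hut⟩ := ((hlim.eventually (lt_mem_nhds (sub_lt_self _ (half_pos hε)))).and
    (Ioo_mem_nhdsGT hst)).exists
  filter_upwards [eventually_le_ncard_of_pos hα hsum hprod (by linarith : 0 < u) hut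
    (half_pos hε)] with n hn
  have hmono : ({x : ℝ | laguerreL n (α n) x = 0} ∩ Set.Ioc (n * u) (n * t)).ncard ≤
      ({x : ℝ | laguerreL n (α n) x = 0} ∩ Set.Ioc (n * s) (n * t)).ncard :=
    Set.ncard_le_ncard (Set.inter_subset_inter_right _ (Set.Ioc_subset_Ioc_left (by gcongr)))
      ((finite_laguerreL_zeros n (α n)).inter_of_left _)
  have hmono' : (({x : ℝ | laguerreL n (α n) x = 0} ∩ Set.Ioc (n * u) (n * t)).ncard : ℝ) ≤
      (({x : ℝ | laguerreL n (α n) x = 0} ∩ Set.Ioc (n * s) (n * t)).ncard : ℝ) := by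
    exact_mod_cast hmono
  exact (mul_le_mul_of_nonneg_left (by linarith) n.cast_nonneg).trans (hn.trans hmono')

end Asymptotics

lemma ncard_inter_Ioc_le_laguerreN (n : ℕ) (α s t : ℝ) :
    ({x : ℝ | laguerreL n α x = 0} ∩ Set.Ioc s t).ncard ≤ laguerreN n α t :=
  Set.ncard_le_ncard (fun _ hx => ⟨hx.1, hx.2.2⟩)
    ((finite_laguerreL_zeros n α).subset fun _ hx => hx.1)

lemma laguerreN_add_ncard_inter_Ioc_le (n : ℕ) (α s t : ℝ) :
    laguerreN n α s + ({x : ℝ | laguerreL n α x = 0} ∩ Set.Ioc s t).ncard ≤ n := by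
  have hfin := finite_laguerreL_zeros n α
  rw [laguerreN, ← Set.ncard_union_eq _ (hfin.subset fun _ hx => hx.1) (hfin.inter_of_left _)]
  · refine (Set.ncard_le_ncard ?_ hfin).trans (ncard_laguerreL_zeros_le n α)
    exact Set.union_subset (fun _ hx => hx.1) Set.inter_subset_left
  · exact Set.disjoint_left.2 fun x hx hx' => hx.2.not_gt hx'.2.1

theorem stmt6 (α : ℕ → ℝ) (a : ℝ) (ha : 0 ≤ a)
    (hα : ∀ n, α n > -1)
    (hαlim : Tendsto (fun n : ℕ => α n / n) atTop (𝓝 a))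
    (r1 r2 : ℝ)
    (hr1 : r1 = 2 + a - 2 * Real.sqrt (1 + a))
    (hr2 : r2 = 2 + a + 2 * Real.sqrt (1 + a))
    (ξ : ℝ) (hξ1 : r1 ≤ ξ) (hξ2 : ξ ≤ r2) :
    Tendsto (fun n : ℕ => (laguerreN n (α n) ((n : ℝ) * ξ) : ℝ) / n)
      atTop (𝓝 (1 / (2 * Real.pi) *
        ∫ x in r1..ξ, Real.sqrt ((r2 - x) * (x - r1)) / x)) := by
  have hq : Real.sqrt (1 + a) ^ 2 = 1 + a := Real.sq_sqrt (by linarith)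
  have hq0 : 0 < Real.sqrt (1 + a) := Real.sqrt_pos.2 (by linarith)
  have hsum : r1 + r2 = 2 * (2 + a) := by rw [hr1, hr2]; ring
  have hprod : r1 * r2 = a ^ 2 := by rw [hr1, hr2]; linear_combination (-4 : ℝ) * hq
  have h12 : r1 < r2 := by rw [hr1, hr2]; linarith
  have h1 : 0 ≤ r1 := by
    rw [hr1]
    linarith [sq_nonneg (Real.sqrt (1 + a) - 1)]
  obtain ⟨hint, hval⟩ := integral_sqrt_div r1 r2 a h1 h12 ha hprod
  have hpi := Real.pi_pos
  have hsub : ∀ x ∈ Set.Icc r1 r2, ∀ y ∈ Set.Icc r1 r2, IntervalIntegrable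
      (fun x => Real.sqrt ((r2 - x) * (x - r1)) / x) MeasureTheory.volume x y := by
    intro x hx y hy
    refine hint.mono_set ?_
    rw [Set.uIcc_of_le h12.le]
    exact Set.uIcc_subset_Icc hx hy
  have htotal : 1 / (2 * Real.pi) * (∫ x in r1..ξ, Real.sqrt ((r2 - x) * (x - r1)) / x)
      + 1 / (2 * Real.pi) * (∫ x in ξ..r2, Real.sqrt ((r2 - x) * (x - r1)) / x) = 1 := by
    rw [← mul_add, intervalIntegral.integral_add_adjacent_intervals
      (hsub r1 ⟨le_rfl, h12.le⟩ ξ ⟨hξ1, hξ2⟩) (hsub ξ ⟨hξ1, hξ2⟩ r2 ⟨h12.le, le_rfl⟩), hval, hsum]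
    field_simp
    ring
  rw [Metric.tendsto_nhds]
  intro ε hε
  filter_upwards [eventually_le_ncard hαlim hsum hprod h1 hint le_rfl hξ1 hξ2 (half_pos hε),
    eventually_le_ncard hαlim hsum hprod h1 hint hξ1 hξ2 le_rfl (half_pos hε),
    eventually_gt_atTop 0] with n hlow hup hn
  have hn0 : (0 : ℝ) < n := by exact_mod_cast hn
  set I := 1 / (2 * Real.pi) * ∫ x in r1..ξ, Real.sqrt ((r2 - x) * (x - r1)) / x with hI
  set J := 1 / (2 * Real.pi) * ∫ x in ξ..r2, Real.sqrt ((r2 - x) * (x - r1)) / x with hJ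
  have hN1 : (({x : ℝ | laguerreL n (α n) x = 0} ∩ Set.Ioc (n * r1) (n * ξ)).ncard : ℝ)
      ≤ laguerreN n (α n) (n * ξ) := by
    exact_mod_cast ncard_inter_Ioc_le_laguerreN n (α n) (n * r1) (n * ξ)
  have hN2 : (laguerreN n (α n) (n * ξ) : ℝ)
      + (({x : ℝ | laguerreL n (α n) x = 0} ∩ Set.Ioc (n * ξ) (n * r2)).ncard : ℝ) ≤ n := by
    exact_mod_cast laguerreN_add_ncard_inter_Ioc_le n (α n) (n * ξ) (n * r2)
  have hge : I - ε / 2 ≤ laguerreN n (α n) (n * ξ) / n := by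
    rw [le_div_iff₀ hn0]
    linarith
  have hle : laguerreN n (α n) (n * ξ) / n ≤ I + ε / 2 := by
    rw [div_le_iff₀ hn0]
    have : (n : ℝ) * (I + J) = n := by rw [htotal, mul_one]
    linarith
  rw [Real.dist_eq, abs_lt]
  constructor <;> linarith
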